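/- Let Γ be an inverse semigroup and let A, B ⊆ Γ be directed sets with A·B·A ∼ A and B·A·B ∼ B. Then B ∼ A⁻¹. (This is the uniqueness of inverses in the inverse semigroup O(Γ) of equivalence classes of directed subsets of Γ.) -/

import Mathlib

/-- An inverse semigroup: a semigroup in which every element `x` has a unique
element `x⁻¹` with `x * x⁻¹ * x = x` and `x⁻¹ * x * x⁻¹ = x⁻¹`. -/
class InverseSemigroup (α : Type*) extends Semigroup α, Inv α where
  mul_inv_mul : ∀ x : α, x * x⁻¹ * x = x
  inv_mul_inv : ∀ x : α, x⁻¹ * x * x⁻¹ = x⁻¹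
  inv_unique : ∀ x y : α, x * y * x = x → y * x * y = y → y = x⁻¹

variable {α : Type*} [InverseSemigroup α]

/-- The natural order on an inverse semigroup: `x ≺ y` iff `x * y⁻¹ = x * x⁻¹`. -/
def prec (x y : α) : Prop := x * y⁻¹ = x * x⁻¹

/-- The idempotents (units) `Γ⁽⁰⁾`: elements `p` with `p = p * p⁻¹`. -/
def IsIdem (p : α) : Prop := p = p * p⁻¹

/-- A zero element: `z * x = z = x * z` for every `x`. -/
def IsZeroEl (z : α) : Prop := ∀ x : α, z * x = z ∧ x * z = z


/-- A subset A is directed if any two of its elements have a common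
precessor in A. -/
def IsDirectedSet (A : Set α) : Prop :=
  ∀ a ∈ A, ∀ b ∈ A, ∃ c ∈ A, prec c a ∧ prec c b

/-- Elementwise product of two subsets. -/
def mulSet (A B : Set α) : Set α := {x | ∃ a ∈ A, ∃ b ∈ B, x = a * b}

/-- Elementwise inverse of a subset. -/
def invSet (A : Set α) : Set α := {x | ∃ a ∈ A, x = a⁻¹}

/-- A ≼ B iff every b ∈ B has some a ∈ A with a ≺ b. -/
def sprec (A B : Set α) : Prop := ∀ b ∈ B, ∃ a ∈ A, prec a b

/-- A ∼ B iff A ≼ B and B ≼ A. -/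
def sequiv (A B : Set α) : Prop := sprec A B ∧ sprec B A


namespace InverseSemigroup

theorem idem_inv {e : α} (he : e * e = e) : e⁻¹ = e :=
  (inv_unique e e (by rw [he, he]) (by rw [he, he])).symm

theorem inv_inv_eq (x : α) : x⁻¹⁻¹ = x :=
  (inv_unique x⁻¹ x (inv_mul_inv x) (mul_inv_mul x)).symm

theorem mul_inv_idem (x : α) : x * x⁻¹ * (x * x⁻¹) = x * x⁻¹ := by
  rw [← mul_assoc, mul_inv_mul]

theorem inv_mul_idem (x : α) : x⁻¹ * x * (x⁻¹ * x) = x⁻¹ * x := by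
  rw [← mul_assoc, inv_mul_inv]

theorem idem_mul_idem {e f : α} (he : e * e = e) (hf : f * f = f) :
    e * f * (e * f) = e * f := by
  have hx1 := mul_inv_mul (e * f)
  have hx2 := inv_mul_inv (e * f)
  have hx : f * (e * f)⁻¹ * e = (e * f)⁻¹ := by
    apply inv_unique <;> generalize (e * f)⁻¹ = x at hx1 hx2 ⊢
    · calc e * f * (f * x * e) * (e * f) = e * (f * f) * x * ((e * e) * f) := by
            simp only [mul_assoc]
        _ = e * f := by rw [he, hf, hx1]
    · calc f * x * e * (e * f) * (f * x * e) = f * (x * ((e * e) * (f * f)) * x) * e := by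
            simp only [mul_assoc]
        _ = f * x * e := by rw [he, hf, hx2]
  have hidem : (e * f)⁻¹ * (e * f)⁻¹ = (e * f)⁻¹ := by
    generalize (e * f)⁻¹ = x at hx hx2
    grind
  have h := idem_inv hidem
  rw [inv_inv_eq] at h
  rwa [← h] at hidem

theorem idem_comm {e f : α} (he : e * e = e) (hf : f * f = f) : e * f = f * e := by
  have h1 := idem_mul_idem he hf
  have h2 := idem_mul_idem hf he
  rw [← idem_inv h1]
  symm
  apply inv_unique
  · grind
  · grind

theorem mul_inv_rev_eq (x y : α) : (x * y)⁻¹ = y⁻¹ * x⁻¹ := by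
  have hc := idem_comm (inv_mul_idem x) (mul_inv_idem y)
  symm
  apply inv_unique
  · calc x * y * (y⁻¹ * x⁻¹) * (x * y) = x * ((y * y⁻¹) * (x⁻¹ * x)) * y := by
          simp only [mul_assoc]
      _ = (x * x⁻¹ * x) * (y * y⁻¹ * y) := by rw [← hc]; simp only [mul_assoc]
      _ = x * y := by rw [mul_inv_mul, mul_inv_mul]
  · calc y⁻¹ * x⁻¹ * (x * y) * (y⁻¹ * x⁻¹) = y⁻¹ * ((x⁻¹ * x) * (y * y⁻¹)) * x⁻¹ := by
          simp only [mul_assoc]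
      _ = (y⁻¹ * y * y⁻¹) * (x⁻¹ * x * x⁻¹) := by rw [hc]; simp only [mul_assoc]
      _ = y⁻¹ * x⁻¹ := by rw [inv_mul_inv, inv_mul_inv]

theorem eq_mul_source_of_prec {x y : α} (h : prec x y) : x = y * (x⁻¹ * x) := by
  have h' := congrArg (·⁻¹) (show x * y⁻¹ = x * x⁻¹ from h)
  simp only [mul_inv_rev_eq, inv_inv_eq] at h'
  rw [← mul_assoc, h', mul_inv_mul]

theorem eq_range_mul_of_prec {x y : α} (h : prec x y) : x = x * x⁻¹ * y := by
  have hxy := eq_mul_source_of_prec h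
  have h' : x * y⁻¹ = x * x⁻¹ := h
  calc x = y * y⁻¹ * y * (x⁻¹ * x) := by rw [mul_inv_mul, ← hxy]
    _ = y * ((y⁻¹ * y) * (x⁻¹ * x)) := by simp only [mul_assoc]
    _ = y * (x⁻¹ * x) * (y⁻¹ * y) := by
        rw [idem_comm (inv_mul_idem y) (inv_mul_idem x)]; simp only [mul_assoc]
    _ = x * x⁻¹ * y := by rw [← hxy, ← mul_assoc, h']

theorem prec_trans {x y z : α} (hxy : prec x y) (hyz : prec y z) : prec x z := by
  have hyz' : y * z⁻¹ = y * y⁻¹ := hyz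
  have hxy' : x * y⁻¹ = x * x⁻¹ := hxy
  change x * z⁻¹ = x * x⁻¹
  calc x * z⁻¹ = x * x⁻¹ * y * z⁻¹ := by rw [← eq_range_mul_of_prec hxy]
    _ = x * x⁻¹ * y * y⁻¹ := by rw [mul_assoc, hyz', ← mul_assoc]
    _ = x * x⁻¹ := by rw [← eq_range_mul_of_prec hxy, hxy']

/-- If `x` lies below both `a` and `a * b * a`, then `b` is an inner inverse of `x`. -/
theorem mul_mul_eq_of_prec {a b x : α} (ha : prec x a) (hab : prec x (a * b * a)) :
    x * b * x = x := by
  have h : x * b * a = x := by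
    calc x * b * a = x * x⁻¹ * a * b * a := by rw [← eq_range_mul_of_prec ha]
      _ = x * x⁻¹ * (a * b * a) := by simp only [mul_assoc]
      _ = x := (eq_range_mul_of_prec hab).symm
  calc x * b * x = x * b * (a * (x⁻¹ * x)) := by rw [← eq_mul_source_of_prec ha]
    _ = x * b * a * (x⁻¹ * x) := by simp only [mul_assoc]
    _ = x := by rw [h, ← mul_assoc, mul_inv_mul]

theorem inv_eq_of_mul_mul_eq {x b : α} (h : x * b * x = x) : x⁻¹ = b * x * b := by
  symm
  apply inv_unique
  · grind
  · grind

theorem prec_inv_of_mul_mul_eq {x b : α} (h : x * b * x = x) : prec x b⁻¹ := by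
  change x * b⁻¹⁻¹ = x * x⁻¹
  rw [inv_inv_eq, inv_eq_of_mul_mul_eq h, ← mul_assoc, ← mul_assoc, h]

theorem inv_prec_of_mul_mul_eq {x b : α} (h : x * b * x = x) : prec x⁻¹ b := by
  have hi : b * x * (b * x) = b * x := by rw [mul_assoc, ← mul_assoc x, h]
  change x⁻¹ * b⁻¹ = x⁻¹ * x⁻¹⁻¹
  rw [inv_inv_eq, inv_eq_of_mul_mul_eq h]
  calc b * x * b * b⁻¹ = (b * x) * (b * b⁻¹) := by simp only [mul_assoc]
    _ = b * b⁻¹ * b * x := by rw [idem_comm hi (mul_inv_idem b)]; simp only [mul_assoc]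
    _ = b * x * (b * x) := by rw [mul_inv_mul, hi]
    _ = b * x * b * x := by simp only [mul_assoc]

theorem exists_mul_mul_eq {A B : Set α} (hA : IsDirectedSet A)
    (h : sprec A (mulSet (mulSet A B) A)) {a b : α} (ha : a ∈ A) (hb : b ∈ B) :
    ∃ x ∈ A, x * b * x = x := by
  obtain ⟨c, hc, hcab⟩ := h (a * b * a) ⟨a * b, ⟨a, ha, b, hb, rfl⟩, a, ha, rfl⟩
  obtain ⟨x, hx, hxa, hxc⟩ := hA a ha c hc
  refine ⟨x, hx, mul_mul_eq_of_prec hxa ?_⟩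
  exact prec_trans hxc hcab

end InverseSemigroup

/-- for directed A, B with A·B·A ∼ A and B·A·B ∼ B one has
B ∼ A⁻¹ (uniqueness of inverses in O(Γ)). -/
theorem stmt7 (A B : Set α) (hA : IsDirectedSet A) (hB : IsDirectedSet B)
    (h1 : sequiv (mulSet (mulSet A B) A) A)
    (h2 : sequiv (mulSet (mulSet B A) B) B) :
    sequiv B (invSet A) := by
  constructor
  · rintro _ ⟨a, ha, rfl⟩
    obtain ⟨_, ⟨_, ⟨_, -, b, hb, rfl⟩, _, -, rfl⟩, -⟩ := h1.1 a ha
    obtain ⟨x, hx, hxa⟩ := InverseSemigroup.exists_mul_mul_eq hB h2.2 hb ha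
    exact ⟨x, hx, InverseSemigroup.prec_inv_of_mul_mul_eq hxa⟩
  · intro b hb
    obtain ⟨_, ⟨_, ⟨_, -, a, ha, rfl⟩, _, -, rfl⟩, -⟩ := h2.1 b hb
    obtain ⟨x, hx, hxb⟩ := InverseSemigroup.exists_mul_mul_eq hA h1.2 ha hb
    exact ⟨x⁻¹, ⟨x, hx, rfl⟩, InverseSemigroup.inv_prec_of_mul_mul_eq hxb⟩
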